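/- Let n ≥ 1 and let A ∈ ℝ^{n×(n+3)} have columns a_1,…,a_{n+3} ∈ ℝⁿ that do not all lie in a single affine hyperplane of ℝⁿ. Then there is an open dense subset U ⊆ ℝ^{n+3} such that for every c ∈ U, the zero set Z_ℝ(g_c) has at most (n+3)(n+2)/2 + ⌊(n+5)/2⌋ connected components. -/

import Mathlib

/-- The exponential sum `g_c(y) = ∑_j c_j · exp(a_j · y)`. -/
noncomputable def expSum {n N : ℕ} (a : Fin N → Fin n → ℝ) (c : Fin N → ℝ)
    (y : Fin n → ℝ) : ℝ :=
  ∑ j, c j * Real.exp (∑ i, a j i * y i)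

/-- The columns `a_1, …, a_N` do not all lie in a single affine hyperplane of ℝⁿ. -/
def NotAllInAffineHyperplane {n N : ℕ} (a : Fin N → Fin n → ℝ) : Prop :=
  ¬ ∃ (w : Fin n → ℝ) (b : ℝ), w ≠ 0 ∧ ∀ j, (∑ i, w i * a j i) = b


lemma mv_lift {n : ℕ} (f : (Fin n → ℝ) → ℝ) (hf : Continuous f)
    (h : {y : Fin n → ℝ // f y = 0} → ℤ) (hh : Continuous h) :
    ∃ u v : C(Fin n → ℝ, ℝ), (∀ z : {y : Fin n → ℝ // f y = 0}, u z.1 = h z) ∧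
      (∀ y, 0 ≤ f y → ∃ k : ℤ, v y - u y = k) ∧ (∀ y, f y ≤ 0 → ∃ k : ℤ, v y = k) := by
  have hcl : IsClosed {y : Fin n → ℝ | f y = 0} := isClosed_eq hf continuous_const
  obtain ⟨u, hu⟩ := ContinuousMap.exists_restrict_eq hcl
    (⟨fun z => ((h z : ℤ) : ℝ), continuous_of_discreteTopology.comp hh⟩ :
      C({y : Fin n → ℝ | f y = 0}, ℝ))
  have hu' : ∀ z : {y : Fin n → ℝ // f y = 0}, u z.1 = h z := fun z =>
    congrArg (fun g => g z) hu
  have hintr : ∀ k : ℤ, ((k : ℝ) : AddCircle (1:ℝ)) = 0 := by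
    intro k
    rw [AddCircle.coe_eq_zero_iff]
    exact ⟨k, by simp⟩
  have hg : Continuous (fun y => if 0 ≤ f y then ((u y : ℝ) : AddCircle (1:ℝ)) else 0) := by
    refine Continuous.if_le ?_ continuous_const continuous_const hf ?_
    · exact (AddCircle.continuous_mk' 1).comp u.continuous
    · intro y hy
      have := hu' ⟨y, hy.symm⟩
      simp only at this
      rw [this, hintr]
  let g : C(Fin n → ℝ, AddCircle (1:ℝ)) := ⟨_, hg⟩
  obtain ⟨e₀, he₀⟩ := QuotientAddGroup.mk_surjective (g 0)
  obtain ⟨v, ⟨_, hv⟩, -⟩ := (AddCircle.isCoveringMap_coe (1:ℝ)).existsUnique_continuousMap_lifts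
    g 0 e₀ he₀
  have hv' : ∀ y, ((v y : ℝ) : AddCircle (1:ℝ)) = g y := fun y => congrFun hv y
  have hlift : ∀ r : ℝ, (r : AddCircle (1:ℝ)) = 0 → ∃ k : ℤ, r = k := by
    intro r hr
    rw [AddCircle.coe_eq_zero_iff] at hr
    obtain ⟨k, hk⟩ := hr
    exact ⟨k, by rw [← hk]; simp⟩
  refine ⟨u, v, hu', ?_, ?_⟩
  · intro y hy
    apply hlift
    have := hv' y
    simp only [g, ContinuousMap.coe_mk, if_pos hy] at this
    rw [AddCircle.coe_sub, this, sub_self]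
  · intro y hy
    apply hlift
    rw [hv' y]
    simp only [g, ContinuousMap.coe_mk]
    split_ifs with h0
    · have := hu' ⟨y, le_antisymm hy h0⟩
      simp only at this
      rw [this, hintr]
    · rfl

lemma int_const {n : ℕ} (g : (Fin n → ℝ) → ℝ) (hg : Continuous g) (S : Set (Fin n → ℝ))
    (hS : IsPreconnected S) (hintr : ∀ y ∈ S, ∃ k : ℤ, g y = k) {y y'} (hy : y ∈ S) (hy' : y' ∈ S) :
    g y = g y' := by
  have := hS.constant_of_mapsTo (T := Set.range ((↑) : ℤ → ℝ)) (f := g)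
    (Int.isClosedEmbedding_coe_real.isEmbedding.isInducing.isDiscrete_range) hg.continuousOn
    (fun y hy => by obtain ⟨k, hk⟩ := hintr y hy; exact ⟨k, hk.symm⟩) hy hy'
  exact this

open Classical in
lemma mv_count {n : ℕ} (f : (Fin n → ℝ) → ℝ) (hf : Continuous f) {TA TB : Type} [Fintype TA]
    [Fintype TB] (la : {y : Fin n → ℝ // 0 ≤ f y} → TA) (lb : {y : Fin n → ℝ // f y ≤ 0} → TB)
    (hla : ∀ y y', la y = la y' →
      ∃ S : Set (Fin n → ℝ), IsPreconnected S ∧ S ⊆ {y | 0 ≤ f y} ∧ y.1 ∈ S ∧ y'.1 ∈ S)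
    (hlb : ∀ y y', lb y = lb y' →
      ∃ S : Set (Fin n → ℝ), IsPreconnected S ∧ S ⊆ {y | f y ≤ 0} ∧ y.1 ∈ S ∧ y'.1 ∈ S)
    (m : ℕ) (e : {y : Fin n → ℝ // f y = 0} → Fin m) (he : Continuous e)
    (hes : Function.Surjective e) : m ≤ Fintype.card TA + Fintype.card TB - 1 := by
  rcases Nat.eq_zero_or_pos m with rfl | hm
  · simp
  obtain ⟨r, hr⟩ := hes.hasRightInverse
  let ra : Fin m → {y : Fin n → ℝ // 0 ≤ f y} := fun i => ⟨(r i).1, (r i).2.ge⟩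
  let rb : Fin m → {y : Fin n → ℝ // f y ≤ 0} := fun i => ⟨(r i).1, (r i).2.le⟩
  let Φ : ((TA → ℝ) × (TB → ℝ)) →ₗ[ℝ] (Fin m → ℝ) :=
    { toFun := fun p i => p.2 (lb (rb i)) - p.1 (la (ra i))
      map_add' := by intro p q; ext i; simp; ring
      map_smul' := by intro t q; ext i; simp; ring }
  have hbasis : ∀ i, Pi.single i (1:ℝ) ∈ LinearMap.range Φ := by
    intro i
    obtain ⟨u, v, h1, h2, h3⟩ := mv_lift f hf (fun z => if e z = i then 1 else 0)
      ((continuous_of_discreteTopology (f := fun k : Fin m => if k = i then (1:ℤ) else 0)).comp he)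
    refine ⟨(fun t => if h : ∃ y, la y = t then v h.choose.1 - u h.choose.1 else 0,
      fun t => if h : ∃ y, lb y = t then v h.choose.1 else 0), ?_⟩
    ext k
    have hA : ∃ y, la y = la (ra k) := ⟨_, rfl⟩
    have hB : ∃ y, lb y = lb (rb k) := ⟨_, rfl⟩
    simp only [Φ, LinearMap.coe_mk, AddHom.coe_mk, dif_pos hA, dif_pos hB]
    have e1 : v hA.choose.1 - u hA.choose.1 = v (r k).1 - u (r k).1 := by
      obtain ⟨S, hS, hSA, m1, m2⟩ := hla _ _ hA.choose_spec
      exact int_const (fun y => v y - u y) (by fun_prop) S hS (fun y hy => h2 y (hSA hy)) m1 m2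
    have e2 : v hB.choose.1 = v (r k).1 := by
      obtain ⟨S, hS, hSA, m1, m2⟩ := hlb _ _ hB.choose_spec
      exact int_const (fun y => v y) (by fun_prop) S hS (fun y hy => h3 y (hSA hy)) m1 m2
    rw [e1, e2, h1 (r k), hr k]
    simp [Pi.single_apply]
  have hsurj : LinearMap.range Φ = ⊤ := by
    rw [eq_top_iff, ← (Pi.basisFun ℝ (Fin m)).span_eq, Submodule.span_le]
    rintro _ ⟨i, rfl⟩
    simpa using hbasis i
  have hker : LinearMap.ker Φ ≠ ⊥ := by
    intro hk
    have hmem : ((fun _ => 1, fun _ => 1) : (TA → ℝ) × (TB → ℝ)) ∈ LinearMap.ker Φ := by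
      rw [LinearMap.mem_ker]; ext i; simp [Φ]
    rw [hk, Submodule.mem_bot] at hmem
    have := congrFun (congrArg Prod.fst hmem) (la (ra ⟨0, hm⟩))
    simp at this
  have h1 := LinearMap.finrank_range_add_finrank_ker Φ
  rw [hsurj, finrank_top] at h1
  simp at h1
  have h2 : 0 < Module.finrank ℝ (LinearMap.ker Φ) :=
    Module.finrank_pos_iff.mpr (Submodule.nontrivial_iff_ne_bot.mpr hker)
  omega

open Classical in
lemma comps_le (Z : Type) [TopologicalSpace Z] (D : ℕ)
    (h : ∀ (m : ℕ) (e : Z → Fin m), Continuous e → Function.Surjective e → m ≤ D) :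
    Finite (ConnectedComponents Z) ∧ Nat.card (ConnectedComponents Z) ≤ D := by
  rcases isEmpty_or_nonempty Z with hZ | hZ
  · have : IsEmpty (ConnectedComponents Z) := ⟨fun x => by
      obtain ⟨z, rfl⟩ := ConnectedComponents.surjective_coe x
      exact hZ.elim z⟩
    exact ⟨inferInstance, by simp⟩
  let P : ℕ → Prop := fun m => ∃ e : Z → Fin m, Continuous e ∧ Function.Surjective e
  have hP1 : P 1 := ⟨fun _ => 0, continuous_const, fun i => ⟨hZ.some, Subsingleton.elim _ _⟩⟩
  have hbd : ∀ m, P m → m ≤ D := fun m ⟨e, h1, h2⟩ => h m e h1 h2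
  have hmax : ∃ m, P m ∧ ∀ m', P m' → m' ≤ m :=
    ⟨Nat.findGreatest P D, Nat.findGreatest_spec (hbd 1 hP1) hP1,
      fun m' hm' => Nat.le_findGreatest (hbd m' hm') hm'⟩
  obtain ⟨m, ⟨e, hec, hes⟩, hmx⟩ := hmax
  have key : ∀ x y : Z, e x = e y → (x : ConnectedComponents Z) = y := by
    have hpre : ∀ i, IsPreconnected (e ⁻¹' {i}) := by
      intro i
      by_contra hcon
      rw [isPreconnected_iff_subset_of_disjoint] at hcon
      push Not at hcon
      obtain ⟨u, v, hu, hv, hsub, hdis, hnu, hnv⟩ := hcon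
      have hop : ∀ i, IsOpen (e ⁻¹' {i}) := fun i => (isOpen_discrete _).preimage hec
      obtain ⟨x, hx, hxu⟩ := Set.not_subset.mp hnu
      obtain ⟨y, hy, hyv⟩ := Set.not_subset.mp hnv
      have hxv : x ∈ v := (hsub hx).resolve_left hxu
      have hyu : y ∈ u := (hsub hy).resolve_right hyv
      let e' : Z → Fin (m+1) := fun z => if z ∈ e ⁻¹' {i} ∩ v then Fin.last m else (e z).castSucc
      have hclopen : IsClopen (e ⁻¹' {i} ∩ v) := by
        refine ⟨?_, (hop i).inter hv⟩
        rw [← isOpen_compl_iff]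
        have : (e ⁻¹' {i} ∩ v)ᶜ = (e ⁻¹' {i} ∩ u) ∪ ⋃ k ∈ {k | k ≠ i}, e ⁻¹' {k} := by
          ext z
          simp only [Set.mem_compl_iff, Set.mem_inter_iff, Set.mem_preimage, Set.mem_singleton_iff,
            Set.mem_union, Set.mem_iUnion, Set.mem_ofPred_eq, exists_prop]
          constructor
          · intro hz
            by_cases hzi : e z = i
            · left
              refine ⟨hzi, (hsub hzi).resolve_right fun h => hz ⟨hzi, h⟩⟩
            · right; exact ⟨_, hzi, rfl⟩
          · rintro (⟨h1, h2⟩ | ⟨k, hk, rfl⟩) ⟨h3, h4⟩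
            · have : z ∈ e ⁻¹' {i} ∩ (u ∩ v) := ⟨h1, h2, h4⟩
              rw [hdis] at this; exact this
            · exact hk h3
        rw [this]
        exact ((hop i).inter hu).union (isOpen_biUnion fun k _ => hop k)
      have hc' : Continuous e' := by
        refine Continuous.if (p := fun z => z ∈ e ⁻¹' {i} ∩ v) ?_ continuous_const
          (continuous_of_discreteTopology.comp hec)
        intro z hz
        have hfr := hclopen.frontier_eq
        change z ∈ frontier (e ⁻¹' {i} ∩ v) at hz
        rw [hfr] at hz
        exact hz.elim
      have hs' : Function.Surjective e' := by
        intro k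
        refine Fin.lastCases ?_ (fun k => ?_) k
        · exact ⟨x, if_pos ⟨hx, hxv⟩⟩
        · by_cases hk : k = i
          · subst hk
            refine ⟨y, ?_⟩
            simp only [e']
            rw [if_neg (fun h => hyv h.2)]
            rw [show e y = k from hy]
          · obtain ⟨z, hz⟩ := hes k
            refine ⟨z, ?_⟩
            simp only [e']
            rw [if_neg (fun h => hk (hz ▸ h.1)), hz]
      have := hmx _ ⟨e', hc', hs'⟩
      omega
    intro x y hxy
    rw [ConnectedComponents.coe_eq_coe]
    have := (hpre (e y)).subset_connectedComponent (x := y) rfl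
    exact (connectedComponent_eq (this hxy)).symm
  have hmD : m ≤ D := hbd m ⟨e, hec, hes⟩
  have hout : ∃ g : ConnectedComponents Z → Fin m, Function.Injective g := by
    refine ⟨fun x => e (ConnectedComponents.surjective_coe x).choose, fun x y hxy => ?_⟩
    have := key _ _ hxy
    rwa [(ConnectedComponents.surjective_coe x).choose_spec,
      (ConnectedComponents.surjective_coe y).choose_spec] at this
  obtain ⟨g, hg⟩ := hout
  refine ⟨Finite.of_injective g hg, ?_⟩
  have := Nat.card_le_card_of_injective g hg
  simp at this
  omega

/-! ### Weights and critical points at infinity -/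

noncomputable def ew {n N : ℕ} (a : Fin N → Fin n → ℝ) (y : Fin n → ℝ) (j : Fin N) : ℝ :=
  Real.exp (∑ i, a j i * y i)

noncomputable def wt {n N : ℕ} (a : Fin N → Fin n → ℝ) (y : Fin n → ℝ) (j : Fin N) : ℝ :=
  ew a y j / ∑ k, ew a y k

def orb {n N : ℕ} (a : Fin N → Fin n → ℝ) : Set (Fin N → ℝ) := closure (Set.range (wt a))

def InK {n N : ℕ} (a : Fin N → Fin n → ℝ) (b : Fin N → ℝ) : Prop :=
  ∑ j, b j = 0 ∧ ∀ i, ∑ j, b j * a j i = 0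

noncomputable def rho {N : ℕ} (c z : Fin N → ℝ) : ℝ := (∑ j, c j * z j) / ∑ j, |c j| * z j

def Crit {n N : ℕ} (a : Fin N → Fin n → ℝ) (c : Fin N → ℝ) : Set (Fin N → ℝ) :=
  {z | z ∈ orb a ∧ |rho c z| < 1 ∧ InK a (fun j => (c j - rho c z * |c j|) * z j)}

set_option linter.unusedSectionVars false

section labels

variable {n N : ℕ} [Nonempty (Fin N)] (a : Fin N → Fin n → ℝ)

lemma ew_pos (y : Fin n → ℝ) (j : Fin N) : 0 < ew a y j := Real.exp_pos _

lemma sum_ew_pos (y : Fin n → ℝ) : 0 < ∑ k, ew a y k :=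
  Finset.sum_pos (fun k _ => ew_pos a y k) Finset.univ_nonempty

lemma wt_pos (y : Fin n → ℝ) (j : Fin N) : 0 < wt a y j := div_pos (ew_pos a y j) (sum_ew_pos a y)

lemma ew_eq (y : Fin n → ℝ) (j : Fin N) : ew a y j = (∑ k, ew a y k) * wt a y j := by
  unfold wt
  field_simp [(sum_ew_pos a y).ne']

lemma log_wt (y : Fin n → ℝ) (j : Fin N) :
    Real.log (wt a y j) = (∑ i, a j i * y i) - Real.log (∑ k, ew a y k) := by
  unfold wt
  rw [Real.log_div (ew_pos a y j).ne' (sum_ew_pos a y).ne']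
  unfold ew
  rw [Real.log_exp]

lemma sum_wt (y : Fin n → ℝ) : ∑ j, wt a y j = 1 := by
  unfold wt
  rw [← Finset.sum_div, div_self (sum_ew_pos a y).ne']

lemma expSum_eq (c : Fin N → ℝ) (y : Fin n → ℝ) :
    expSum a c y = (∑ k, ew a y k) * ∑ j, c j * wt a y j := by
  rw [Finset.mul_sum]
  unfold expSum
  refine Finset.sum_congr rfl fun j _ => ?_
  have := ew_eq a y j
  rw [show Real.exp (∑ i, a j i * y i) = ew a y j from rfl, this]
  ring

lemma wt_simplex (y : Fin n → ℝ) : wt a y ∈ stdSimplex ℝ (Fin N) :=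
  ⟨fun j => (wt_pos a y j).le, sum_wt a y⟩

lemma orb_subset : orb a ⊆ stdSimplex ℝ (Fin N) :=
  closure_minimal (by rintro _ ⟨y, rfl⟩; exact wt_simplex a y) (isClosed_stdSimplex ..)

lemma orb_compact : IsCompact (orb a) :=
  (isCompact_stdSimplex ..).of_isClosed_subset isClosed_closure (orb_subset a)

lemma absum_pos {N : ℕ} {c z : Fin N → ℝ} (hc : ∀ j, c j ≠ 0) (hz : z ∈ stdSimplex ℝ (Fin N)) :
    0 < ∑ j, |c j| * z j := by
  have h0 : ∀ j ∈ Finset.univ, 0 ≤ |c j| * z j := fun j _ => mul_nonneg (abs_nonneg _) (hz.1 j)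
  refine lt_of_le_of_ne (Finset.sum_nonneg h0) fun h => ?_
  have h1 := (Finset.sum_eq_zero_iff_of_nonneg h0).mp h.symm
  have : ∑ j, z j = 0 := Finset.sum_eq_zero fun j hj => by
    have := h1 j hj
    simpa [hc j] using this
  rw [hz.2] at this
  exact one_ne_zero this

lemma rho_mul {N : ℕ} {c z : Fin N → ℝ} (hc : ∀ j, c j ≠ 0) (hz : z ∈ stdSimplex ℝ (Fin N)) :
    ∑ j, c j * z j = rho c z * ∑ j, |c j| * z j := by
  unfold rho
  rw [div_mul_cancel₀ _ (absum_pos hc hz).ne']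

lemma abs_rho_le {N : ℕ} {c z : Fin N → ℝ} (hc : ∀ j, c j ≠ 0) (hz : z ∈ stdSimplex ℝ (Fin N)) :
    |rho c z| ≤ 1 := by
  unfold rho
  rw [abs_div, abs_of_pos (absum_pos hc hz), div_le_one (absum_pos hc hz)]
  refine (Finset.abs_sum_le_sum_abs _ _).trans (Finset.sum_le_sum fun j _ => ?_)
  rw [abs_mul, abs_of_nonneg (hz.1 j)]

lemma rho_continuousAt {N : ℕ} {c z : Fin N → ℝ} (hc : ∀ j, c j ≠ 0)
    (hz : z ∈ stdSimplex ℝ (Fin N)) : ContinuousAt (rho c) z := by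
  unfold rho
  refine ContinuousAt.div ?_ ?_ (absum_pos hc hz).ne'
  · exact (continuous_finsetSum _ fun j _ => continuous_const.mul (continuous_apply j)).continuousAt
  · exact (continuous_finsetSum _ fun j _ => continuous_const.mul (continuous_apply j)).continuousAt

lemma expSum_continuous (c : Fin N → ℝ) : Continuous (expSum a c) := by
  unfold expSum
  fun_prop

lemma rho_wt_nonneg {c : Fin N → ℝ} (hc : ∀ j, c j ≠ 0) (y : Fin n → ℝ) :
    0 ≤ expSum a c y ↔ 0 ≤ rho c (wt a y) := by
  rw [expSum_eq, rho_mul hc (wt_simplex a y), mul_nonneg_iff_of_pos_left (sum_ew_pos a y),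
    mul_nonneg_iff_of_pos_right (absum_pos hc (wt_simplex a y))]

lemma seg_pos (c : Fin N → ℝ) (y y' : Fin n → ℝ) (lo hi : Fin N → ℝ)
    (h1 : ∀ j, lo j ≤ wt a y j) (h2 : ∀ j, lo j ≤ wt a y' j)
    (h3 : ∀ j, wt a y j ≤ hi j) (h4 : ∀ j, wt a y' j ≤ hi j)
    (hq : ∀ q : Fin N → ℝ, (∀ j, lo j ≤ q j) → (∀ j, q j ≤ hi j) → 0 < ∑ j, c j * q j) :
    segment ℝ y y' ⊆ {y | 0 ≤ expSum a c y} := by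
  rintro _ ⟨s, t, hs, ht, hst, rfl⟩
  have hA := sum_ew_pos a y
  have hB := sum_ew_pos a y'
  set A := ∑ k, ew a y k with hAd
  set B := ∑ k, ew a y' k with hBd
  let q : Fin N → ℝ := fun j => Real.exp (s * Real.log (wt a y j) + t * Real.log (wt a y' j))
  have key : ∀ j, Real.exp (∑ i, a j i * (s • y + t • y') i) =
      Real.exp (s * Real.log A + t * Real.log B) * q j := by
    intro j
    have e1 : Real.log (wt a y j) = (∑ i, a j i * y i) - Real.log A := log_wt a y j
    have e2 : Real.log (wt a y' j) = (∑ i, a j i * y' i) - Real.log B := log_wt a y' j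
    simp only [q, e1, e2]
    rw [← Real.exp_add]
    congr 1
    have : ∑ i, a j i * (s • y + t • y') i = s * ∑ i, a j i * y i + t * ∑ i, a j i * y' i := by
      rw [Finset.mul_sum, Finset.mul_sum, ← Finset.sum_add_distrib]
      refine Finset.sum_congr rfl fun i _ => ?_
      simp; ring
    rw [this]; ring
  have hlo : ∀ j, lo j ≤ q j := by
    intro j
    have hm : min (wt a y j) (wt a y' j) ≤ q j := by
      have hmp : 0 < min (wt a y j) (wt a y' j) := lt_min (wt_pos a y j) (wt_pos a y' j)
      rw [← Real.exp_log hmp]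
      apply Real.exp_le_exp.mpr
      have l1 := Real.log_le_log hmp (min_le_left _ _)
      have l2 := Real.log_le_log hmp (min_le_right _ _)
      have l3 := mul_le_mul_of_nonneg_left l1 hs
      have l4 := mul_le_mul_of_nonneg_left l2 ht
      have l5 : ∀ x : ℝ, x = s * x + t * x := fun x => by rw [← add_mul, hst, one_mul]
      have l6 := l5 (Real.log (min (wt a y j) (wt a y' j)))
      linarith
    exact (le_min (h1 j) (h2 j)).trans hm
  have hhi : ∀ j, q j ≤ hi j := by
    intro j
    have hm : q j ≤ max (wt a y j) (wt a y' j) := by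
      have hmp : 0 < max (wt a y j) (wt a y' j) := lt_max_of_lt_left (wt_pos a y j)
      rw [← Real.exp_log hmp]
      apply Real.exp_le_exp.mpr
      have l1 := Real.log_le_log (wt_pos a y j) (le_max_left (wt a y j) (wt a y' j))
      have l2 := Real.log_le_log (wt_pos a y' j) (le_max_right (wt a y j) (wt a y' j))
      have l3 := mul_le_mul_of_nonneg_left l1 hs
      have l4 := mul_le_mul_of_nonneg_left l2 ht
      have l5 : ∀ x : ℝ, x = s * x + t * x := fun x => by rw [← add_mul, hst, one_mul]
      have l6 := l5 (Real.log (max (wt a y j) (wt a y' j)))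
      linarith
    exact hm.trans (max_le (h3 j) (h4 j))
  have hpos := hq q hlo hhi
  have : expSum a c (s • y + t • y') =
      Real.exp (s * Real.log A + t * Real.log B) * ∑ j, c j * q j := by
    unfold expSum
    rw [Finset.mul_sum]
    refine Finset.sum_congr rfl fun j _ => ?_
    rw [key]; ring
  change 0 ≤ expSum a c (s • y + t • y')
  rw [this]
  positivity

lemma merge (c : Fin N → ℝ) (y₀ y₀' : Fin n → ℝ) (z z' : Fin N → ℝ)
    (hz : z ∈ closure (wt a '' connectedComponentIn {y | 0 ≤ expSum a c y} y₀))
    (hz' : z' ∈ closure (wt a '' connectedComponentIn {y | 0 ≤ expSum a c y} y₀'))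
    (δ : ℝ) (hδ : 0 < δ)
    (hq : ∀ q : Fin N → ℝ, (∀ j, min (z j) (z' j) - δ ≤ q j) →
      (∀ j, q j ≤ max (z j) (z' j) + δ) → 0 < ∑ j, c j * q j) :
    connectedComponentIn {y | 0 ≤ expSum a c y} y₀ =
      connectedComponentIn {y | 0 ≤ expSum a c y} y₀' := by
  obtain ⟨_, ⟨y, hy, rfl⟩, hd⟩ := Metric.mem_closure_iff.mp hz δ hδ
  obtain ⟨_, ⟨y', hy', rfl⟩, hd'⟩ := Metric.mem_closure_iff.mp hz' δ hδ
  have e1 : ∀ j, |z j - wt a y j| < δ := fun j => (dist_le_pi_dist z (wt a y) j).trans_lt hd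
  have e2 : ∀ j, |z' j - wt a y' j| < δ := fun j => (dist_le_pi_dist z' (wt a y') j).trans_lt hd'
  have hseg := seg_pos a c y y' (fun j => min (z j) (z' j) - δ) (fun j => max (z j) (z' j) + δ)
    (fun j => by have := abs_lt.mp (e1 j); have := min_le_left (z j) (z' j); linarith)
    (fun j => by have := abs_lt.mp (e2 j); have := min_le_right (z j) (z' j); linarith)
    (fun j => by have := abs_lt.mp (e1 j); have := le_max_left (z j) (z' j); linarith)
    (fun j => by have := abs_lt.mp (e2 j); have := le_max_right (z j) (z' j); linarith) hq
  have hcon : IsPreconnected (segment ℝ y y') := (convex_segment y y').isPreconnected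
  have hmem := hcon.subset_connectedComponentIn (left_mem_segment ℝ y y') hseg
    (right_mem_segment ℝ y y')
  rw [connectedComponentIn_eq hy, connectedComponentIn_eq hy', connectedComponentIn_eq hmem]

end labels

section labels2

variable {n N : ℕ} [Nonempty (Fin N)] (a : Fin N → Fin n → ℝ)

lemma ew_shift (y : Fin n → ℝ) (i : Fin n) (ε s : ℝ) (j : Fin N) :
    ew a (y + s • Pi.single i ε) j = ew a y j * Real.exp (s * (ε * a j i)) := by
  unfold ew
  rw [← Real.exp_add]
  congr 1
  have : ∀ k, a j k * (y + s • (Pi.single i ε : Fin n → ℝ)) k =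
      a j k * y k + (if k = i then s * (ε * a j i) else 0) := by
    intro k
    by_cases hk : k = i
    · subst hk; simp; ring
    · simp [hk]
  rw [Finset.sum_congr rfl fun k _ => this k, Finset.sum_add_distrib]
  simp

lemma expSum_shift (c : Fin N → ℝ) (y : Fin n → ℝ) (i : Fin n) (ε s : ℝ) :
    expSum a c (y + s • Pi.single i ε) =
      (∑ k, ew a y k) * ∑ j, c j * wt a y j * Real.exp (s * (ε * a j i)) := by
  rw [Finset.mul_sum]
  unfold expSum
  refine Finset.sum_congr rfl fun j _ => ?_
  have := ew_shift a y i ε s j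
  rw [ew_eq a y j] at this
  rw [show Real.exp (∑ k, a j k * (y + s • (Pi.single i ε : Fin n → ℝ)) k) =
    ew a (y + s • Pi.single i ε) j from rfl, this]
  ring

lemma rho_wt {c : Fin N → ℝ} (y : Fin n → ℝ) :
    rho c (wt a y) = expSum a c y / expSum a (fun j => |c j|) y := by
  unfold rho
  rw [expSum_eq, expSum_eq, mul_div_mul_left _ _ (sum_ew_pos a y).ne']

lemma crit_exists {c : Fin N → ℝ} (hc : ∀ j, c j ≠ 0) (y₀ : Fin n → ℝ) (hy₀ : 0 ≤ expSum a c y₀) :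
    ∃ z ∈ closure (wt a '' connectedComponentIn {y | 0 ≤ expSum a c y} y₀),
      0 ≤ rho c z ∧ InK a (fun j => (c j - rho c z * |c j|) * z j) := by
  set C := connectedComponentIn {y | 0 ≤ expSum a c y} y₀ with hC
  have hy₀C : y₀ ∈ C := mem_connectedComponentIn hy₀
  have hCA : ∀ y ∈ C, 0 ≤ expSum a c y := fun y hy =>
    (connectedComponentIn_subset {y | 0 ≤ expSum a c y} y₀ hy)
  have hsub : closure (wt a '' C) ⊆ stdSimplex ℝ (Fin N) :=
    (closure_mono (Set.image_subset_range _ _)).trans (orb_subset a)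
  have hcomp : IsCompact (closure (wt a '' C)) :=
    (isCompact_stdSimplex ..).of_isClosed_subset isClosed_closure hsub
  obtain ⟨z, hz, hmax⟩ := hcomp.exists_isMaxOn ⟨wt a y₀, subset_closure ⟨y₀, hy₀C, rfl⟩⟩
    (f := rho c) (fun z hz => (rho_continuousAt hc (hsub hz)).continuousWithinAt)
  have hmax' : ∀ y ∈ C, rho c (wt a y) ≤ rho c z := fun y hy => hmax (subset_closure ⟨y, hy, rfl⟩)
  refine ⟨z, hz, ((rho_wt_nonneg a hc y₀).mp hy₀).trans (hmax' y₀ hy₀C), ?_, ?_⟩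
  · have := rho_mul hc (hsub hz)
    simp only [sub_mul, Finset.sum_sub_distrib, mul_assoc, ← Finset.mul_sum]
    linarith
  intro i
  by_contra hne
  obtain ⟨ε, hε⟩ : ∃ ε : ℝ, 0 < ∑ j, (c j - rho c z * |c j|) * z j * (ε * a j i) := by
    refine ⟨∑ j, (c j - rho c z * |c j|) * z j * a j i, ?_⟩
    have : ∀ e : ℝ, ∑ j, (c j - rho c z * |c j|) * z j * (e * a j i) =
      e * ∑ j, (c j - rho c z * |c j|) * z j * a j i := by
      intro e
      rw [Finset.mul_sum]
      refine Finset.sum_congr rfl fun j _ => by ring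
    rw [this]
    exact mul_self_pos.mpr hne
  set α : Fin N → ℝ := fun j => ε * a j i with hα
  set D := ∑ j, (c j - rho c z * |c j|) * z j * α j with hD
  let F : (Fin N → ℝ) × ℝ → ℝ := fun p =>
    ∑ j, (c j - rho c p.1 * |c j|) * p.1 j * (α j * Real.exp (p.2 * α j))
  have hFz : F (z, 0) = D := by simp [F, hD]
  have hFc : ContinuousAt F (z, 0) := by
    have hr : ContinuousAt (fun p : (Fin N → ℝ) × ℝ => rho c p.1) (z, 0) :=
      ContinuousAt.comp (f := Prod.fst) (x := (z, (0:ℝ))) (rho_continuousAt hc (hsub hz))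
        continuousAt_fst
    refine tendsto_finsetSum _ fun j _ => ?_
    have h2 : ContinuousAt (fun p : (Fin N → ℝ) × ℝ => p.1 j) (z, 0) :=
      ((continuous_apply j).comp continuous_fst).continuousAt
    have h3 : ContinuousAt (fun p : (Fin N → ℝ) × ℝ => α j * Real.exp (p.2 * α j)) (z, 0) := by
      fun_prop
    exact ((continuousAt_const.sub (hr.mul continuousAt_const)).mul h2).mul h3
  have hev : ∀ᶠ p in nhds (z, (0:ℝ)), D / 2 < F p :=
    hFc.eventually (lt_mem_nhds (by rw [hFz]; linarith))
  obtain ⟨δ, hδ, hball⟩ := Metric.eventually_nhds_iff.mp hev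
  set s₀ := δ / 2 with hs₀
  have hs₀p : 0 < s₀ := by positivity
  set B := ∑ j, |c j| * Real.exp (s₀ * α j) with hB
  have hBp : 0 < B := Finset.sum_pos
    (fun j _ => mul_pos (abs_pos.mpr (hc j)) (Real.exp_pos _)) Finset.univ_nonempty
  have hev2 : ∀ᶠ u in nhds z, rho c z - s₀ * (D / 2) / B < rho c u ∧ dist u z < δ :=
    ((rho_continuousAt hc (hsub hz)).eventually
      (lt_mem_nhds (sub_lt_self _ (by positivity)))).and (Metric.ball_mem_nhds z hδ)
  obtain ⟨_, ⟨hu1, hu2⟩, ⟨y, hyC, rfl⟩⟩ := mem_closure_iff_nhds.mp hz _ hev2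
  set u := wt a y with hu
  have hus := wt_simplex a y
  let G : ℝ → ℝ := fun s => ∑ j, (c j - rho c u * |c j|) * u j * Real.exp (s * α j)
  have hG0 : G 0 = 0 := by
    have := rho_mul hc hus
    simp only [G, zero_mul, Real.exp_zero, mul_one]
    simp only [sub_mul, Finset.sum_sub_distrib, mul_assoc, ← Finset.mul_sum]
    linarith
  have hGd : ∀ s, HasDerivAt G (F (u, s)) s := by
    intro s
    refine HasDerivAt.fun_sum fun j _ => ?_
    have h1 : HasDerivAt (fun s => Real.exp (s * α j)) (Real.exp (s * α j) * (1 * α j)) s :=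
      ((hasDerivAt_id s).mul_const (α j)).exp
    refine (h1.const_mul ((c j - rho c u * |c j|) * u j)).congr_deriv ?_
    rw [one_mul, mul_comm (Real.exp _)]
  have hGs : ∀ s ∈ Set.Icc 0 s₀, D / 2 * s ≤ G s := by
    intro s hs
    have := (convex_Icc (0:ℝ) s₀).mul_sub_le_image_sub_of_le_deriv (f := G) (C := D / 2)
      (fun s _ => (hGd s).continuousAt.continuousWithinAt)
      (fun s _ => (hGd s).differentiableAt.differentiableWithinAt)
      (fun s hs => by
        rw [(hGd s).deriv]
        refine (hball ?_).le
        rw [interior_Icc] at hs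
        rw [Prod.dist_eq, max_lt_iff]
        refine ⟨hu2, ?_⟩
        simp only [dist_zero_right, Real.norm_eq_abs]
        rw [abs_of_pos hs.1]
        linarith [hs.2]) 0 ⟨le_rfl, hs₀p.le⟩ s hs hs.1
    rw [hG0] at this
    linarith
  have hGsplit : ∀ s, G s = ∑ j, c j * u j * Real.exp (s * α j) -
      rho c u * ∑ j, |c j| * u j * Real.exp (s * α j) := by
    intro s
    simp only [G]
    rw [Finset.mul_sum, ← Finset.sum_sub_distrib]
    refine Finset.sum_congr rfl fun j _ => by ring
  have hnn : ∀ s, 0 ≤ ∑ j, |c j| * u j * Real.exp (s * α j) := fun s =>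
    Finset.sum_nonneg fun j _ => mul_nonneg (mul_nonneg (abs_nonneg _) (hus.1 j)) (Real.exp_pos _).le
  have hru : 0 ≤ rho c u := (rho_wt_nonneg a hc y).mp (hCA y hyC)
  have hseg : segment ℝ y (y + s₀ • Pi.single i ε) ⊆ {y | 0 ≤ expSum a c y} := by
    rw [segment_eq_image']
    rintro _ ⟨t, ht, rfl⟩
    have he : y + t • (y + s₀ • (Pi.single i ε : Fin n → ℝ) - y) = y + (t * s₀) • Pi.single i ε := by
      rw [add_sub_cancel_left, smul_smul]
    change 0 ≤ expSum a c (y + t • (y + s₀ • (Pi.single i ε : Fin n → ℝ) - y))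
    rw [he, expSum_shift]
    refine mul_nonneg (sum_ew_pos a y).le ?_
    have h1 := hGs (t * s₀) ⟨mul_nonneg ht.1 hs₀p.le, by nlinarith [ht.2]⟩
    rw [hGsplit] at h1
    have h2 := mul_nonneg hru (hnn (t * s₀))
    have h3 : 0 ≤ D / 2 * (t * s₀) := mul_nonneg (by linarith) (mul_nonneg ht.1 hs₀p.le)
    linarith
  have hmem : y + s₀ • Pi.single i ε ∈ C := by
    have := (convex_segment y (y + s₀ • Pi.single i ε)).isPreconnected.subset_connectedComponentIn
      (left_mem_segment ℝ y _) hseg (right_mem_segment ℝ y _)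
    rwa [hC, connectedComponentIn_eq hyC]
  have hle := hmax' _ hmem
  have habs : ∀ j, |c j| ≠ 0 := fun j => abs_ne_zero.mpr (hc j)
  have hMpos : 0 < ∑ j, |c j| * u j * Real.exp (s₀ * α j) :=
    Finset.sum_pos (fun j _ => mul_pos (mul_pos (abs_pos.mpr (hc j)) (wt_pos a y j))
      (Real.exp_pos _)) Finset.univ_nonempty
  rw [rho_wt, expSum_shift, expSum_shift, mul_div_mul_left _ _ (sum_ew_pos a y).ne',
    div_le_iff₀ hMpos] at hle
  have hG1 := hGs s₀ ⟨hs₀p.le, le_rfl⟩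
  rw [hGsplit] at hG1
  have hMB : ∑ j, |c j| * u j * Real.exp (s₀ * α j) ≤ B := by
    refine Finset.sum_le_sum fun j _ => ?_
    have : u j ≤ 1 := by
      rw [← hus.2]
      exact Finset.single_le_sum (fun k _ => hus.1 k) (Finset.mem_univ j)
    exact mul_le_mul_of_nonneg_right (mul_le_of_le_one_right (abs_nonneg _) this) (Real.exp_pos _).le
  have hu1' : (rho c z - rho c u) * B < s₀ * (D / 2) := by
    rw [← lt_div_iff₀ hBp]; linarith
  have hd : 0 ≤ rho c z - rho c u := by linarith [hmax' y hyC]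
  have h5 := mul_le_mul_of_nonneg_left hMB hd
  linarith

open Classical in
lemma labels {c : Fin N → ℝ} (hc : ∀ j, c j ≠ 0) (hreg : ∀ z ∈ Crit a c, rho c z ≠ 0) :
    ∃ la : {y : Fin n → ℝ // 0 ≤ expSum a c y} →
        ({i // 0 < c i} ⊕ {z // z ∈ Crit a c ∧ 0 < rho c z}),
      ∀ y y', la y = la y' → ∃ S : Set (Fin n → ℝ), IsPreconnected S ∧
        S ⊆ {y | 0 ≤ expSum a c y} ∧ y.1 ∈ S ∧ y'.1 ∈ S := by
  have hsub : ∀ C : Set (Fin n → ℝ), closure (wt a '' C) ⊆ orb a := fun C =>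
    closure_mono (Set.image_subset_range _ _)
  have key : ∀ y : {y : Fin n → ℝ // 0 ≤ expSum a c y},
      ∃ l : ({i // 0 < c i} ⊕ {z // z ∈ Crit a c ∧ 0 < rho c z}),
      ∃ z ∈ closure (wt a '' connectedComponentIn {y | 0 ≤ expSum a c y} y.1),
        match l with
        | .inl i => (∀ j, c j < 0 → z j = 0) ∧ 0 < z i.1
        | .inr z' => z = z'.1 := by
    intro y
    obtain ⟨z, hz, h0, hK⟩ := crit_exists a hc y.1 y.2
    have hzo := hsub _ hz
    have hzs := orb_subset a hzo
    by_cases h1 : |rho c z| < 1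
    · have hcr : z ∈ Crit a c := ⟨hzo, h1, hK⟩
      exact ⟨.inr ⟨z, hcr, lt_of_le_of_ne h0 (hreg z hcr).symm⟩, z, hz, rfl⟩
    · have hr1 : rho c z = 1 := by
        have := abs_rho_le hc hzs
        rw [abs_of_nonneg h0] at *
        linarith
      have hsum := hK.1
      simp only [hr1, one_mul] at hsum
      have hneg : ∀ j ∈ Finset.univ, (c j - |c j|) * z j ≤ 0 := fun j _ =>
        mul_nonpos_of_nonpos_of_nonneg (by linarith [le_abs_self (c j)]) (hzs.1 j)
      have hz0 := (Finset.sum_eq_zero_iff_of_nonpos hneg).mp hsum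
      have hz0' : ∀ j, c j < 0 → z j = 0 := by
        intro j hj
        have := hz0 j (Finset.mem_univ j)
        rcases mul_eq_zero.mp this with h | h
        · rw [abs_of_neg hj] at h; linarith
        · exact h
      obtain ⟨i, hi⟩ : ∃ i, 0 < z i := by
        by_contra hcon
        push Not at hcon
        have : ∑ j, z j ≤ 0 := Finset.sum_nonpos fun j _ => hcon j
        rw [hzs.2] at this
        linarith
      have hci : 0 < c i := by
        rcases lt_or_gt_of_ne (hc i) with h | h
        · have := hz0' i h; linarith
        · exact h
      exact ⟨.inl ⟨i, hci⟩, z, hz, hz0', hi⟩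
  choose la z hz hla using key
  refine ⟨la, fun y y' hyy' => ⟨_, isPreconnected_connectedComponentIn,
    connectedComponentIn_subset {y | 0 ≤ expSum a c y} y.1, mem_connectedComponentIn y.2, ?_⟩⟩
  have hBp : 0 < ∑ j, |c j| :=
    Finset.sum_pos (fun j _ => abs_pos.mpr (hc j)) Finset.univ_nonempty
  set B := ∑ j, |c j| with hB
  have hfin : connectedComponentIn {y | 0 ≤ expSum a c y} y.1 =
      connectedComponentIn {y | 0 ≤ expSum a c y} y'.1 := by
    have h1 := hla y
    have h2 := hla y'
    rw [← hyy'] at h2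
    have hzs := orb_subset a (hsub _ (hz y))
    have hzs' := orb_subset a (hsub _ (hz y'))
    cases hl : la y with
    | inl i =>
      rw [hl] at h1 h2
      simp only at h1 h2
      have hm : 0 < min (z y i.1) (z y' i.1) := lt_min h1.2 h2.2
      have hcm : 0 < c i.1 * min (z y i.1) (z y' i.1) := mul_pos i.2 hm
      have hδ : 0 < c i.1 * min (z y i.1) (z y' i.1) / (2 * B) := by positivity
      refine merge a c _ _ _ _ (hz y) (hz y') _ hδ ?_
      set δ := c i.1 * min (z y i.1) (z y' i.1) / (2 * B) with hδd
      intro q q1 q2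
      have hterm : ∀ j, (if j = i.1 then c i.1 * min (z y i.1) (z y' i.1) else 0) - |c j| * δ
          ≤ c j * q j := by
        intro j
        rcases lt_or_gt_of_ne (hc j) with h | h
        · have hji : j ≠ i.1 := fun h' => by rw [h'] at h; exact absurd i.2 (not_lt.mpr h.le)
          rw [if_neg hji, abs_of_neg h]
          have := q2 j
          rw [h1.1 j h, h2.1 j h, max_self] at this
          nlinarith
        · rw [abs_of_pos h]
          have := q1 j
          split_ifs with hji
          · subst hji
            nlinarith
          · have : 0 ≤ min (z y j) (z y' j) := le_min (hzs.1 j) (hzs'.1 j)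
            nlinarith
      have := Finset.sum_le_sum fun j (_ : j ∈ Finset.univ) => hterm j
      rw [Finset.sum_sub_distrib, ← Finset.sum_mul, ← hB] at this
      simp only [Finset.sum_ite_eq', Finset.mem_univ, if_true] at this
      have hBδ : B * δ = c i.1 * min (z y i.1) (z y' i.1) / 2 := by
        rw [hδd]; field_simp
      linarith
    | inr w =>
      rw [hl] at h1 h2
      simp only at h1 h2
      have hL : 0 < ∑ j, c j * z y j := by
        rw [rho_mul hc hzs, h1]
        have := absum_pos hc hzs
        rw [h1] at this
        exact mul_pos w.2.2 this
      set L := ∑ j, c j * z y j with hLd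
      have hzz : z y' = z y := by rw [h1, h2]
      have hδ : 0 < L / (2 * B) := by positivity
      refine merge a c _ _ _ _ (hz y) (hz y') _ hδ ?_
      set δ := L / (2 * B) with hδd
      intro q q1 q2
      have hterm : ∀ j, c j * z y j - |c j| * δ ≤ c j * q j := by
        intro j
        have e1 := q1 j
        have e2 := q2 j
        rw [hzz, min_self] at e1
        rw [hzz, max_self] at e2
        rcases lt_or_gt_of_ne (hc j) with h | h
        · rw [abs_of_neg h]; nlinarith
        · rw [abs_of_pos h]; nlinarith
      have := Finset.sum_le_sum fun j (_ : j ∈ Finset.univ) => hterm j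
      rw [Finset.sum_sub_distrib, ← Finset.sum_mul, ← hB] at this
      have hBδ : B * δ = L / 2 := by
        rw [hδd]; field_simp
      linarith
  rw [hfin]
  exact mem_connectedComponentIn y'.2

end labels2

/-! ### Counting on the line -/

section line

variable {N : ℕ}

lemma h_deriv (p q σ : Fin N → ℝ) (s : ℝ) (hs : ∀ j, q j ≠ 0 → 0 < σ j * (p j + s * q j)) :
    HasDerivAt (fun s => ∑ j, q j * Real.log (p j + s * q j))
      (∑ j, q j * (q j / (p j + s * q j))) s := by
  refine HasDerivAt.fun_sum fun j _ => ?_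
  by_cases hq : q j = 0
  · simp only [hq, zero_mul]
    exact hasDerivAt_const _ _
  · have hne : p j + s * q j ≠ 0 := fun h => by have := hs j hq; rw [h] at this; simp at this
    have h1 : HasDerivAt (fun s => p j + s * q j) (q j) s := by
      simpa using ((hasDerivAt_id s).mul_const (q j)).const_add (p j)
    exact (h1.log hne).const_mul (q j)

open Polynomial in
open Classical in
noncomputable def lineP (p q : Fin N → ℝ) : ℝ[X] :=
  ∑ j ∈ Finset.univ.filter (fun j => q j ≠ 0),
    C (q j * q j) * ∏ i ∈ (Finset.univ.filter (fun j => q j ≠ 0)).erase j, (C (p i) + X * C (q i))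

open Polynomial in
lemma lineP_deg (p q : Fin N → ℝ) : (lineP p q).natDegree ≤ N - 1 := by
  classical
  unfold lineP
  refine natDegree_sum_le_of_forall_le _ _ fun j hj => ?_
  refine (natDegree_C_mul_le _ _).trans ((natDegree_prod_le _ _).trans ?_)
  have : ∀ i ∈ (Finset.univ.filter (fun j => q j ≠ 0)).erase j,
      (C (p i) + X * C (q i)).natDegree ≤ 1 := by
    intro i _
    refine (natDegree_add_le _ _).trans ?_
    simp only [natDegree_C, zero_le, sup_of_le_right]
    exact (natDegree_mul_C_le _ _).trans natDegree_X_le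
  refine (Finset.sum_le_card_nsmul _ _ 1 this).trans ?_
  rw [Finset.card_erase_of_mem hj, smul_eq_mul, mul_one]
  have := Finset.card_filter_le (Finset.univ : Finset (Fin N)) (fun j => q j ≠ 0)
  simp only [Finset.card_univ, Fintype.card_fin] at this
  omega

open Polynomial in
lemma lineP_eval (p q σ : Fin N → ℝ) (s : ℝ) (hs : ∀ j, q j ≠ 0 → 0 < σ j * (p j + s * q j)) :
    ∃ M : ℝ, M ≠ 0 ∧ (lineP p q).eval s = M * ∑ j, q j * (q j / (p j + s * q j)) := by
  classical
  have hne : ∀ j, q j ≠ 0 → p j + s * q j ≠ 0 := fun j hj h => by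
    have := hs j hj; rw [h] at this; simp at this
  refine ⟨∏ i ∈ Finset.univ.filter (fun j => q j ≠ 0), (p i + s * q i), ?_, ?_⟩
  · exact Finset.prod_ne_zero_iff.mpr fun i hi => hne i (by simpa using hi)
  · have hrestrict : ∑ j, q j * (q j / (p j + s * q j)) =
        ∑ j ∈ Finset.univ.filter (fun j => q j ≠ 0), q j * (q j / (p j + s * q j)) := by
      symm
      refine Finset.sum_filter_of_ne fun j _ h hq => h (by simp [hq])
    rw [hrestrict, Finset.mul_sum]
    unfold lineP
    rw [eval_finsetSum]
    refine Finset.sum_congr rfl fun j hj => ?_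
    rw [← Finset.mul_prod_erase _ _ hj]
    have := hne j (by simpa using hj)
    simp only [eval_mul, eval_C, eval_prod, eval_add, eval_X]
    generalize p j + s * q j = d at this ⊢
    field_simp

lemma line_conv (p q σ : Fin N → ℝ) {s t r : ℝ} (hs : ∀ j, q j ≠ 0 → 0 < σ j * (p j + s * q j))
    (ht : ∀ j, q j ≠ 0 → 0 < σ j * (p j + t * q j)) (h1 : s ≤ r) (h2 : r ≤ t) :
    ∀ j, q j ≠ 0 → 0 < σ j * (p j + r * q j) := by
  intro j hj
  have e1 := hs j hj
  have e2 := ht j hj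
  by_cases hp : 0 ≤ σ j * q j
  · nlinarith
  · nlinarith

lemma line_count (p q σ : Fin N → ℝ) (κ s₀ : ℝ)
    (hs₀ : ∀ j, q j ≠ 0 → 0 < σ j * (p j + s₀ * q j))
    (hκ : ∑ j, q j * Real.log (p j + s₀ * q j) ≠ κ) (S : Finset ℝ)
    (hS : ∀ s ∈ S, (∀ j, q j ≠ 0 → 0 < σ j * (p j + s * q j)) ∧
      ∑ j, q j * Real.log (p j + s * q j) = κ) : S.card ≤ N := by
  set h : ℝ → ℝ := fun s => ∑ j, q j * Real.log (p j + s * q j) with hh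
  rcases S.eq_empty_or_nonempty with rfl | ⟨s₁, hs₁⟩
  · simp
  have hN : 0 < N := by
    rcases Nat.eq_zero_or_pos N with rfl | h
    · exact absurd (hS s₁ hs₁).2 (by simpa using hκ)
    · exact h
  have hP : lineP p q ≠ 0 := by
    intro hP0
    have hz : ∀ s, (∀ j, q j ≠ 0 → 0 < σ j * (p j + s * q j)) →
        ∑ j, q j * (q j / (p j + s * q j)) = 0 := by
      intro s hs
      obtain ⟨M, hM, he⟩ := lineP_eval p q σ s hs
      rw [hP0] at he
      simp only [Polynomial.eval_zero] at he
      exact (mul_eq_zero.mp he.symm).resolve_left hM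
    have hcst : ∀ s t, s < t → (∀ j, q j ≠ 0 → 0 < σ j * (p j + s * q j)) →
        (∀ j, q j ≠ 0 → 0 < σ j * (p j + t * q j)) → h s = h t := by
      intro s t hst hs ht
      have hd : ∀ r ∈ Set.Icc s t, HasDerivAt h 0 r := fun r hr => by
        have hr' := line_conv p q σ hs ht hr.1 hr.2
        have := h_deriv p q σ r hr'
        rwa [hz r hr'] at this
      obtain ⟨r, hr, he⟩ := exists_hasDerivAt_eq_slope h (fun _ => 0) hst
        (fun r hr => (hd r hr).continuousAt.continuousWithinAt)
        (fun r hr => hd r (Set.Ioo_subset_Icc_self hr))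
      have : t - s ≠ 0 := by linarith
      field_simp at he
      linarith
    rcases lt_trichotomy s₀ s₁ with hlt | heq | hlt
    · exact hκ ((hcst _ _ hlt hs₀ (hS s₁ hs₁).1).trans (hS s₁ hs₁).2)
    · exact hκ (heq ▸ (hS s₁ hs₁).2)
    · exact hκ ((hcst _ _ hlt (hS s₁ hs₁).1 hs₀).symm.trans (hS s₁ hs₁).2)
  obtain ⟨m, hm⟩ : ∃ m, S.card = m + 1 :=
    ⟨S.card - 1, by have := Finset.card_pos.mpr ⟨s₁, hs₁⟩; omega⟩
  let e := S.orderEmbOfFin hm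
  have heS : ∀ i, e i ∈ S := fun i => S.orderEmbOfFin_mem hm i
  have hroll : ∀ i : Fin m, ∃ r ∈ Set.Ioo (e i.castSucc) (e i.succ), (lineP p q).eval r = 0 := by
    intro i
    have hlt : e i.castSucc < e i.succ := e.strictMono (Fin.castSucc_lt_succ)
    have hA := hS _ (heS i.castSucc)
    have hB := hS _ (heS i.succ)
    have hI : ∀ r ∈ Set.Icc (e i.castSucc) (e i.succ), ∀ j, q j ≠ 0 → 0 < σ j * (p j + r * q j) :=
      fun r hr => line_conv p q σ hA.1 hB.1 hr.1 hr.2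
    obtain ⟨r, hr, he⟩ := exists_hasDerivAt_eq_zero (f := h)
      (f' := fun s => ∑ j, q j * (q j / (p j + s * q j))) hlt
      (fun r hr => (h_deriv p q σ r (hI r hr)).continuousAt.continuousWithinAt)
      (hA.2.trans hB.2.symm)
      (fun r hr => h_deriv p q σ r (hI r (Set.Ioo_subset_Icc_self hr)))
    refine ⟨r, hr, ?_⟩
    obtain ⟨M, -, hM⟩ := lineP_eval p q σ r (hI r (Set.Ioo_subset_Icc_self hr))
    rw [hM, he, mul_zero]
  choose r hr hr0 using hroll
  have hmono : StrictMono r := by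
    intro i k hik
    have h1 := (hr i).2
    have h2 := (hr k).1
    have h3 : e i.succ ≤ e k.castSucc := e.monotone (by
      rw [Fin.le_def]; simp; exact hik)
    linarith
  have hsub : Finset.univ.image r ⊆ (lineP p q).roots.toFinset := by
    intro x hx
    obtain ⟨i, -, rfl⟩ := Finset.mem_image.mp hx
    rw [Multiset.mem_toFinset, Polynomial.mem_roots hP]
    exact hr0 i
  have hc := Finset.card_le_card hsub
  rw [Finset.card_image_of_injective _ hmono.injective, Finset.card_univ, Fintype.card_fin] at hc
  have h2 := (lineP p q).roots.toFinset_card_le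
  have h3 := (lineP p q).card_roots'
  have h4 := lineP_deg p q
  omega

lemma bd_count (p q σ : Fin N → ℝ) (S : Finset ℝ)
    (hS : ∀ s ∈ S, (∀ j, 0 ≤ σ j * (p j + s * q j)) ∧ ∃ j, σ j * q j ≠ 0 ∧ p j + s * q j = 0) :
    S.card ≤ 2 := by
  by_contra hcon
  push Not at hcon
  obtain ⟨T, hT, hT3⟩ := Finset.exists_subset_card_eq (s := S) (n := 3) hcon
  let e := T.orderEmbOfFin hT3
  have heS : ∀ i, e i ∈ S := fun i => hT (T.orderEmbOfFin_mem hT3 i)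
  have h01 : e 0 < e 1 := e.strictMono (by decide)
  have h12 : e 1 < e 2 := e.strictMono (by decide)
  obtain ⟨-, j, hj, h0⟩ := hS _ (heS 1)
  have h1 := (hS _ (heS 0)).1 j
  have h2 := (hS _ (heS 2)).1 j
  have e1 : p j = - (e 1 * q j) := by linarith
  rw [e1] at h1 h2
  have h1' : 0 ≤ (σ j * q j) * (e 0 - e 1) := by linarith
  have h2' : 0 ≤ (σ j * q j) * (e 2 - e 1) := by linarith
  rcases lt_or_gt_of_ne hj with h | h
  · nlinarith
  · nlinarith

end line

/-! ### Counting critical points -/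

section critcount

variable {n N : ℕ} [Nonempty (Fin N)] (a : Fin N → Fin n → ℝ)

lemma log_rel {b z : Fin N → ℝ} (hz : z ∈ orb a) (hb : InK a b) (h0 : ∀ j, z j = 0 → b j = 0) :
    ∑ j, b j * Real.log (z j) = 0 := by
  have hcont : ContinuousAt (fun w : Fin N → ℝ => ∑ j, b j * Real.log (w j)) z := by
    refine tendsto_finsetSum _ fun j _ => ?_
    by_cases hj : z j = 0
    · simp only [h0 j hj, zero_mul]
      exact tendsto_const_nhds
    · exact ((continuousAt_apply j z).log hj).const_mul (b j)
  have hm : Set.MapsTo (fun w : Fin N → ℝ => ∑ j, b j * Real.log (w j)) (Set.range (wt a)) {0} := by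
    rintro _ ⟨y, rfl⟩
    simp only [Set.mem_singleton_iff, log_wt, mul_sub, Finset.sum_sub_distrib]
    rw [← Finset.sum_mul, hb.1, zero_mul, sub_zero]
    simp only [Finset.mul_sum]
    rw [Finset.sum_comm]
    refine Finset.sum_eq_zero fun i _ => ?_
    have := hb.2 i
    calc ∑ j, b j * (a j i * y i) = (∑ j, b j * a j i) * y i := by
          rw [Finset.sum_mul]
          exact Finset.sum_congr rfl fun j _ => by ring
      _ = 0 := by rw [this, zero_mul]
  have := hcont.continuousWithinAt.mem_closure hz hm
  simpa using this

/-- The sign vector data. -/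
def IsSign {N : ℕ} (σ c : Fin N → ℝ) : Prop := ∀ j, (σ j = 1 ∨ σ j = -1) ∧ 0 < σ j * c j

lemma sign_abs {σ c : Fin N → ℝ} (h : IsSign σ c) (j : Fin N) : c j = σ j * |c j| := by
  obtain ⟨h1, h2⟩ := h j
  rcases h1 with h1 | h1 <;> rw [h1] at h2 ⊢
  · rw [abs_of_pos (by linarith)]; ring
  · rw [abs_of_neg (by linarith)]; ring

lemma sign_ne {σ c : Fin N → ℝ} (h : IsSign σ c) (j : Fin N) : c j ≠ 0 := fun h0 => by
  have := (h j).2; rw [h0] at this; simp at this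

lemma one_sub_pos {σ c : Fin N → ℝ} (h : IsSign σ c) {r : ℝ} (hr : |r| < 1) (j : Fin N) :
    0 < 1 - σ j * r := by
  have := abs_lt.mp hr
  rcases (h j).1 with h1 | h1 <;> rw [h1] <;> linarith

lemma x_eq {σ c : Fin N → ℝ} (h : IsSign σ c) (r w : ℝ) (j : Fin N) :
    (c j - r * |c j|) * w = σ j * (|c j| * (1 - σ j * r) * w) := by
  have h1 := sign_abs h j
  have h2 : σ j * σ j = 1 := by rcases (h j).1 with h1 | h1 <;> rw [h1] <;> norm_num
  have : σ j * (|c j| * (1 - σ j * r) * w) = (σ j * |c j| - (σ j * σ j) * r * |c j|) * w := by ring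
  rw [this, ← h1, h2, one_mul]

lemma x_zero {σ c : Fin N → ℝ} (h : IsSign σ c) {r : ℝ} (hr : |r| < 1) (w : ℝ) (j : Fin N) :
    (c j - r * |c j|) * w = 0 ↔ w = 0 := by
  rw [x_eq h]
  have h1 : σ j ≠ 0 := by rcases (h j).1 with h1 | h1 <;> rw [h1] <;> norm_num
  have h2 := one_sub_pos h hr j
  have h3 : |c j| ≠ 0 := abs_ne_zero.mpr (sign_ne h j)
  simp [h1, h2.ne', sign_ne h j]

lemma crit_rho_le {σ c : Fin N → ℝ} (h : IsSign σ c) {z z' : Fin N → ℝ} (hz : z ∈ Crit a c)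
    (hz' : z' ∈ Crit a c) {t : ℝ} (ht : 0 < t)
    (hx : ∀ j, (c j - rho c z * |c j|) * z j = t * ((c j - rho c z' * |c j|) * z' j)) :
    rho c z' ≤ rho c z := by
  by_contra hlt
  push Not at hlt
  obtain ⟨ho, hr, hk⟩ := hz
  obtain ⟨ho', hr', hk'⟩ := hz'
  have hsz := orb_subset a ho
  have hsz' := orb_subset a ho'
  have e1 := log_rel a ho hk (fun j hj => by simp [hj])
  have e2 := log_rel a ho' hk (fun j hj => by
    show (c j - rho c z * |c j|) * z j = 0
    rw [hx j, hj]; ring)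
  have e3 : ∑ j, ((c j - rho c z * |c j|) * z j) *
      (Real.log (z j) - Real.log (z' j) - Real.log t) = 0 := by
    simp only [mul_sub, Finset.sum_sub_distrib]
    rw [e1, e2, ← Finset.sum_mul, hk.1]
    ring
  have hterm : ∀ j, z j ≠ 0 → ((c j - rho c z * |c j|) * z j) *
      (Real.log (z j) - Real.log (z' j) - Real.log t) < 0 := by
    intro j hj
    have hzp : 0 < z j := lt_of_le_of_ne (hsz.1 j) (Ne.symm hj)
    have hj' : z' j ≠ 0 := fun h0 => by
      have h1 := hx j
      rw [h0, mul_zero, mul_zero] at h1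
      exact hj ((x_zero h hr _ j).mp h1)
    have hzp' : 0 < z' j := lt_of_le_of_ne (hsz'.1 j) (Ne.symm hj')
    have p1 := one_sub_pos h hr j
    have p2 := one_sub_pos h hr' j
    have pc : 0 < |c j| := abs_pos.mpr (sign_ne h j)
    have hσ : σ j ≠ 0 := by rcases (h j).1 with h1 | h1 <;> rw [h1] <;> norm_num
    have hxj := hx j
    rw [x_eq h, x_eq h] at hxj
    have h4 : (1 - σ j * rho c z) * z j = t * ((1 - σ j * rho c z') * z' j) := by
      have : (σ j * |c j|) * ((1 - σ j * rho c z) * z j) =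
        (σ j * |c j|) * (t * ((1 - σ j * rho c z') * z' j)) := by linarith
      exact mul_left_cancel₀ (mul_ne_zero hσ pc.ne') this
    have h5 := congrArg Real.log h4
    rw [Real.log_mul p1.ne' hj, Real.log_mul ht.ne' (mul_pos p2 hzp').ne',
      Real.log_mul p2.ne' hj'] at h5
    have h6 : Real.log (z j) - Real.log (z' j) - Real.log t =
      Real.log (1 - σ j * rho c z') - Real.log (1 - σ j * rho c z) := by linarith
    rw [h6, x_eq h]
    have pp : 0 < |c j| * (1 - σ j * rho c z) * z j := by positivity
    rcases (h j).1 with h1 | h1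
    · have : Real.log (1 - σ j * rho c z') < Real.log (1 - σ j * rho c z) :=
        Real.log_lt_log p2 (by rw [h1]; linarith)
      nth_rewrite 1 [h1]
      nlinarith
    · have : Real.log (1 - σ j * rho c z) < Real.log (1 - σ j * rho c z') :=
        Real.log_lt_log p1 (by rw [h1]; linarith)
      nth_rewrite 1 [h1]
      nlinarith
  obtain ⟨j₀, hj₀⟩ : ∃ j, z j ≠ 0 := by
    by_contra hall
    push Not at hall
    have := hsz.2
    simp [hall] at this
  have : ∑ j, ((c j - rho c z * |c j|) * z j) *
      (Real.log (z j) - Real.log (z' j) - Real.log t) < 0 := by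
    refine Finset.sum_neg' (fun j _ => ?_) ⟨j₀, Finset.mem_univ _, hterm j₀ hj₀⟩
    by_cases hj : z j = 0
    · simp [hj]
    · exact (hterm j hj).le
  linarith

lemma crit_inj {σ c : Fin N → ℝ} (h : IsSign σ c) {z z' : Fin N → ℝ} (hz : z ∈ Crit a c)
    (hz' : z' ∈ Crit a c) {t : ℝ} (ht : 0 < t)
    (hx : ∀ j, (c j - rho c z * |c j|) * z j = t * ((c j - rho c z' * |c j|) * z' j)) :
    z = z' := by
  have h1 := crit_rho_le a h hz hz' ht hx
  have h2 := crit_rho_le a h hz' hz (inv_pos.mpr ht) (fun j => by rw [hx j]; field_simp)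
  have he : rho c z = rho c z' := le_antisymm h2 h1
  have hzt : ∀ j, z j = t * z' j := by
    intro j
    have h3 := hx j
    rw [← he] at h3
    have h4 : (c j - rho c z * |c j|) * (z j - t * z' j) = 0 := by linarith
    have := (x_zero h hz.2.1 _ j).mp h4
    linarith
  have s1 := (orb_subset a hz.1).2
  have s2 := (orb_subset a hz'.1).2
  have : t = 1 := by
    rw [Finset.sum_congr rfl fun j _ => hzt j, ← Finset.mul_sum, s2] at s1
    linarith
  funext j
  rw [hzt j, this, one_mul]

lemma crit_ell {σ c : Fin N → ℝ} (h : IsSign σ c) {z : Fin N → ℝ} (hz : z ∈ Crit a c) :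
    (∀ j, 0 ≤ σ j * ((c j - rho c z * |c j|) * z j)) ∧
    0 < ∑ j, σ j * ((c j - rho c z * |c j|) * z j) := by
  have hsz := orb_subset a hz.1
  have e : ∀ j, σ j * ((c j - rho c z * |c j|) * z j) = |c j| * (1 - σ j * rho c z) * z j := by
    intro j
    rw [x_eq h, ← mul_assoc]
    rcases (h j).1 with h1 | h1 <;> simp [h1]
  have h0 : ∀ j, 0 ≤ σ j * ((c j - rho c z * |c j|) * z j) := by
    intro j
    rw [e j]
    have := one_sub_pos h hz.2.1 j
    have := hsz.1 j
    positivity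
  refine ⟨h0, ?_⟩
  obtain ⟨j₀, hj₀⟩ : ∃ j, z j ≠ 0 := by
    by_contra hall
    push Not at hall
    have := hsz.2
    simp [hall] at this
  refine Finset.sum_pos' (fun j _ => h0 j) ⟨j₀, Finset.mem_univ _, ?_⟩
  refine lt_of_le_of_ne (h0 j₀) (Ne.symm ?_)
  refine mul_ne_zero ?_ ((x_zero h hz.2.1 _ j₀).not.mpr hj₀)
  rcases (h j₀).1 with h1 | h1 <;> rw [h1] <;> norm_num

lemma crit_line {σ c : Fin N → ℝ} (h : IsSign σ c) {z : Fin N → ℝ} (hz : z ∈ Crit a c)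
    {p q : Fin N → ℝ} (hq : InK a q) (hq0 : ∑ j, σ j * q j = 0) {τ s : ℝ} (hτ : 0 < τ)
    (hx : ∀ j, (c j - rho c z * |c j|) * z j = τ * (p j + s * q j))
    (hs : ∀ j, q j ≠ 0 → 0 < σ j * (p j + s * q j)) :
    ∑ j, q j * Real.log (p j + s * q j) = ∑ j, q j * Real.log |c j| := by
  have hsz := orb_subset a hz.1
  have hne : ∀ j, q j ≠ 0 → p j + s * q j ≠ 0 := fun j hj h0 => by
    have := hs j hj; rw [h0] at this; simp at this
  have hznz : ∀ j, z j = 0 → q j = 0 := by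
    intro j hj
    by_contra hqj
    have h1 := hx j
    rw [hj, mul_zero] at h1
    exact mul_ne_zero hτ.ne' (hne j hqj) h1.symm
  have e1 := log_rel a hz.1 hq hznz
  set r := rho c z with hr
  set A := (Real.log (1 - r) + Real.log (1 + r)) / 2 with hA
  set B := (Real.log (1 - r) - Real.log (1 + r)) / 2 with hB
  have key : ∀ j, q j * Real.log (p j + s * q j) = q j * Real.log |c j| + q j * Real.log (z j) +
      q j * A + σ j * q j * B - q j * Real.log τ := by
    intro j
    by_cases hqj : q j = 0
    · simp [hqj]
    have hzj : z j ≠ 0 := fun h0 => hqj (hznz j h0)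
    have p1 := one_sub_pos h hz.2.1 j
    have pc : |c j| ≠ 0 := abs_ne_zero.mpr (sign_ne h j)
    have h1 := hx j
    rw [x_eq h] at h1
    have h2 := congrArg Real.log h1
    rw [Real.log_mul hτ.ne' (hne j hqj)] at h2
    have h3 : Real.log (σ j * (|c j| * (1 - σ j * rho c z) * z j)) =
        Real.log (|c j| * (1 - σ j * rho c z) * z j) := by
      rcases (h j).1 with h1 | h1
      · rw [h1, one_mul]
      · rw [show σ j * (|c j| * (1 - σ j * rho c z) * z j) =
          -(|c j| * (1 - σ j * rho c z) * z j) by nth_rewrite 1 [h1]; ring, Real.log_neg_eq_log]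
    rw [h3, Real.log_mul (mul_ne_zero pc p1.ne') hzj, Real.log_mul pc p1.ne'] at h2
    have h4 : Real.log (1 - σ j * rho c z) = A + σ j * B := by
      rcases (h j).1 with h1 | h1 <;> rw [h1, hA, hB, ← hr]
      · rw [one_mul]; ring
      · rw [show 1 - -1 * r = 1 + r by ring]; ring
    rw [h4] at h2
    have h5 : Real.log (p j + s * q j) =
      Real.log |c j| + (A + σ j * B) + Real.log (z j) - Real.log τ := by linarith
    rw [h5]; ring
  rw [Finset.sum_congr rfl fun j _ => key j]
  simp only [Finset.sum_sub_distrib, Finset.sum_add_distrib]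
  rw [← Finset.sum_mul, ← Finset.sum_mul, ← Finset.sum_mul, hq.1, hq0, e1]
  ring

lemma crit_count {σ c : Fin N → ℝ} (h : IsSign σ c) {p q : Fin N → ℝ} (hq : InK a q)
    (hq0 : ∑ j, σ j * q j = 0)
    (hline : ∀ x, InK a x → ∑ j, σ j * x j = 1 → ∃ s, ∀ j, x j = p j + s * q j)
    (hgen : ∀ s, (∀ j, q j ≠ 0 → 0 < σ j * (p j + s * q j)) →
      ∃ s₀, (∀ j, q j ≠ 0 → 0 < σ j * (p j + s₀ * q j)) ∧
        ∑ j, q j * Real.log (p j + s₀ * q j) ≠ ∑ j, q j * Real.log |c j|)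
    (T : Finset (Fin N → ℝ)) (hT : ∀ z ∈ T, z ∈ Crit a c) : T.card ≤ N + 2 := by
  classical
  have hex : ∀ z ∈ Crit a c, ∃ s τ : ℝ, 0 < τ ∧
      ∀ j, (c j - rho c z * |c j|) * z j = τ * (p j + s * q j) := by
    intro z hz
    obtain ⟨-, h2⟩ := crit_ell a h hz
    set τ := ∑ j, σ j * ((c j - rho c z * |c j|) * z j) with hτ
    obtain ⟨s, hs⟩ := hline (fun j => τ⁻¹ * ((c j - rho c z * |c j|) * z j))
      (by
        constructor
        · rw [← Finset.mul_sum, hz.2.2.1, mul_zero]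
        · intro i
          have := hz.2.2.2 i
          simp only [mul_assoc] at this ⊢
          rw [← Finset.mul_sum, this, mul_zero])
      (by
        have : ∀ j, σ j * (τ⁻¹ * ((c j - rho c z * |c j|) * z j)) =
          τ⁻¹ * (σ j * ((c j - rho c z * |c j|) * z j)) := fun j => by ring
        rw [Finset.sum_congr rfl fun j _ => this j, ← Finset.mul_sum, ← hτ, inv_mul_cancel₀ h2.ne'])
    refine ⟨s, τ, h2, fun j => ?_⟩
    rw [← hs j]
    field_simp
  choose! sf tf htf hsf using hex
  have hinj : Set.InjOn sf T := by
    intro z hz z' hz' he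
    have hz := hT z hz
    have hz' := hT z' hz'
    refine crit_inj a h hz hz' (t := tf z / tf z') (div_pos (htf z hz) (htf z' hz')) fun j => ?_
    rw [hsf z hz, hsf z' hz', he]
    have := (htf z' hz').ne'
    field_simp
  rw [← Finset.card_image_of_injOn hinj]
  set S := T.image sf with hS
  have hSs : ∀ s ∈ S, (∀ j, 0 ≤ σ j * (p j + s * q j)) ∧
      ((∀ j, q j ≠ 0 → 0 < σ j * (p j + s * q j)) →
        ∑ j, q j * Real.log (p j + s * q j) = ∑ j, q j * Real.log |c j|) := by
    intro s hs
    obtain ⟨z, hz, rfl⟩ := Finset.mem_image.mp hs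
    have hz := hT z hz
    refine ⟨fun j => ?_, fun hi => crit_line a h hz hq hq0 (htf z hz) (hsf z hz) hi⟩
    have h1 := (crit_ell a h hz).1 j
    rw [hsf z hz] at h1
    have h2 : 0 ≤ tf z * (σ j * (p j + sf z * q j)) := by linarith
    exact nonneg_of_mul_nonneg_right h2 (htf z hz)
  rw [← Finset.card_filter_add_card_filter_not
    (fun s => ∀ j, q j ≠ 0 → 0 < σ j * (p j + s * q j))]
  refine add_le_add ?_ ?_
  · by_cases hne : ∃ s, (∀ j, q j ≠ 0 → 0 < σ j * (p j + s * q j))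
    · obtain ⟨s, hs⟩ := hne
      obtain ⟨s₀, h1, h2⟩ := hgen s hs
      refine line_count p q σ _ s₀ h1 h2 _ fun s hs => ?_
      rw [Finset.mem_filter] at hs
      exact ⟨hs.2, (hSs s hs.1).2 hs.2⟩
    · rw [Finset.filter_false_of_mem fun s _ hs => hne ⟨s, hs⟩]
      simp
  · refine bd_count p q σ _ fun s hs => ?_
    rw [Finset.mem_filter] at hs
    refine ⟨(hSs s hs.1).1, ?_⟩
    have h2 := hs.2
    push Not at h2
    obtain ⟨j, hj, hj2⟩ := h2
    have hσ : σ j ≠ 0 := by rcases (h j).1 with h1 | h1 <;> rw [h1] <;> norm_num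
    refine ⟨j, mul_ne_zero hσ hj, ?_⟩
    have h3 := le_antisymm hj2 ((hSs s hs.1).1 j)
    exact (mul_eq_zero.mp h3).resolve_left hσ

end critcount

/-! ### Genericity -/

section generic

lemma ker_gen {V : Type*} [AddCommGroup V] [Module ℝ V] (m : V →ₗ[ℝ] ℝ)
    (h : Module.finrank ℝ (LinearMap.ker m) = 1) :
    ∃ v : LinearMap.ker m, v ≠ 0 ∧ ∀ w : LinearMap.ker m, ∃ s : ℝ, s • v = w :=
  finrank_eq_one_iff'.mp h

lemma line_exists {n : ℕ} (a : Fin (n + 3) → Fin n → ℝ) (ha : NotAllInAffineHyperplane a)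
    (σ : Fin (n + 3) → ℝ) :
    (∀ x, InK a x → ∑ j, σ j * x j = 0) ∨
    ∃ p q : Fin (n + 3) → ℝ, InK a q ∧ ∑ j, σ j * q j = 0 ∧ q ≠ 0 ∧
      ∀ x, InK a x → ∑ j, σ j * x j = 1 → ∃ s, ∀ j, x j = p j + s * q j := by
  by_cases hall : ∀ x, InK a x → ∑ j, σ j * x j = 0
  · exact Or.inl hall
  right
  push Not at hall
  obtain ⟨x₀, hx₀, hx₀1⟩ := hall
  let L : (Fin (n + 3) → ℝ) →ₗ[ℝ] (Fin n → ℝ) × ℝ :=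
    { toFun := fun b => (fun i => ∑ j, b j * a j i, ∑ j, b j)
      map_add' := fun b b' => by
        ext <;> simp [add_mul, Finset.sum_add_distrib]
      map_smul' := fun t b => by
        ext <;> simp [mul_assoc, Finset.mul_sum] }
  have hker : ∀ b, b ∈ LinearMap.ker L ↔ InK a b := by
    intro b
    rw [LinearMap.mem_ker]
    simp only [L, LinearMap.coe_mk, AddHom.coe_mk, Prod.mk_eq_zero, InK, funext_iff, Pi.zero_apply]
    tauto
  have hsurj : LinearMap.range L = ⊤ := by
    by_contra hne
    obtain ⟨f, hf0, hf⟩ := Submodule.exists_le_ker_of_lt_top _ (lt_top_iff_ne_top.mpr hne)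
    have hfe : ∀ (v : Fin n → ℝ) (t : ℝ), f (v, t) = ∑ i, f (Pi.single i 1, 0) * v i + t * f (0, 1) := by
      intro v t
      have h1 : ((v, t) : (Fin n → ℝ) × ℝ) =
          ∑ i, v i • ((Pi.single i 1 : Fin n → ℝ), (0 : ℝ)) + t • ((0 : Fin n → ℝ), (1 : ℝ)) := by
        ext i
        · simp [Prod.fst_sum, Finset.sum_apply, Pi.single_apply]
        · simp [Prod.snd_sum]
      rw [h1, map_add, map_sum]
      simp only [map_smul, smul_eq_mul]
      congr 1
      exact Finset.sum_congr rfl fun i _ => mul_comm _ _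
    have hcol : ∀ j, ∑ i, f (Pi.single i 1, 0) * a j i + f (0, 1) = 0 := by
      intro j
      have h1 : f (L (Pi.single j 1)) = 0 := hf ⟨_, rfl⟩
      have h2 : L (Pi.single j 1) = (a j, 1) := by
        ext <;> simp [L, Pi.single_apply]
      rw [h2, hfe, one_mul] at h1
      exact h1
    apply ha
    refine ⟨fun i => f (Pi.single i 1, 0), - f (0, 1), ?_, fun j => by linarith [hcol j]⟩
    intro hw
    have hw' : ∀ i, f (Pi.single i 1, 0) = 0 := fun i => congrFun hw i
    have h1 := hcol 0
    simp only [hw', zero_mul, Finset.sum_const_zero, zero_add] at h1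
    apply hf0
    refine LinearMap.ext fun ⟨v, t⟩ => ?_
    rw [hfe, h1]
    simp [hw']
  have hK : Module.finrank ℝ (LinearMap.ker L) = 2 := by
    have h1 := LinearMap.finrank_range_add_finrank_ker L
    rw [hsurj, finrank_top] at h1
    simp at h1
    omega
  let ℓ : (Fin (n + 3) → ℝ) →ₗ[ℝ] ℝ :=
    { toFun := fun b => ∑ j, σ j * b j
      map_add' := fun b b' => by simp [mul_add, Finset.sum_add_distrib]
      map_smul' := fun t b => by
        simp only [Pi.smul_apply, smul_eq_mul, RingHom.id_apply, Finset.mul_sum]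
        exact Finset.sum_congr rfl fun j _ => by ring }
  let m := ℓ.domRestrict (LinearMap.ker L)
  have hm0 : m ≠ 0 := by
    intro h0
    have : m ⟨x₀, (hker x₀).mpr hx₀⟩ = 0 := by rw [h0]; rfl
    exact hx₀1 this
  have hmk : Module.finrank ℝ (LinearMap.ker m) = 1 := by
    have h1 := LinearMap.finrank_range_add_finrank_ker m
    rw [LinearMap.range_eq_top.mpr (LinearMap.surjective hm0), finrank_top, hK] at h1
    simp at h1
    omega
  obtain ⟨v, hv0, hv⟩ := ker_gen m hmk
  obtain ⟨p, hp⟩ := LinearMap.surjective hm0 1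
  refine ⟨p.1, v.1.1, (hker _).mp v.1.2, v.2, ?_, ?_⟩
  · intro h0
    apply hv0
    ext1; ext1
    exact h0
  · intro x hx hx1
    have hxk : m (⟨x, (hker x).mpr hx⟩ - p) = 0 := by
      rw [map_sub, hp]
      have : m ⟨x, (hker x).mpr hx⟩ = 1 := hx1
      rw [this, sub_self]
    obtain ⟨s, hs⟩ := hv ⟨_, hxk⟩
    refine ⟨s, fun j => ?_⟩
    have h1 := congrArg (fun w : LinearMap.ker m => w.1.1 j) hs
    simp only [Submodule.coe_smul, Pi.smul_apply, smul_eq_mul, Submodule.coe_sub,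
      Pi.sub_apply] at h1
    linarith

lemma step1 {n : ℕ} (a : Fin (n + 3) → Fin n → ℝ) (ha : NotAllInAffineHyperplane a)
    (V : Set (Fin (n + 3) → ℝ)) (hV : IsOpen V) (hVn : V.Nonempty) :
    ∃ V1 ⊆ V, IsOpen V1 ∧ V1.Nonempty ∧ ∀ c ∈ V1, (∀ j, c j ≠ 0) ∧
      ∀ T : Finset (Fin (n + 3) → ℝ), (∀ z ∈ T, z ∈ Crit a c) → T.card ≤ n + 3 + 2 := by
  classical
  have hd : Dense (Set.pi Set.univ fun _ : Fin (n + 3) => ({0}ᶜ : Set ℝ)) :=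
    dense_pi _ fun i _ => dense_compl_singleton (0 : ℝ)
  obtain ⟨c0, hc0V, hc0⟩ := hd.inter_open_nonempty V hV hVn
  have hc0' : ∀ j, c0 j ≠ 0 := fun j => hc0 j (Set.mem_univ _)
  let σ : Fin (n + 3) → ℝ := fun j => if 0 < c0 j then 1 else -1
  have hσ0 : IsSign σ c0 := by
    intro j
    by_cases h : 0 < c0 j
    · simp [σ, h]
    · have : c0 j < 0 := lt_of_le_of_ne (not_lt.mp h) (hc0' j)
      simp [σ, h, this]
  set V0 := V ∩ {c | ∀ j, 0 < σ j * c j} with hV0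
  have hσV : ∀ c ∈ V0, IsSign σ c := fun c hc j => ⟨(hσ0 j).1, hc.2 j⟩
  have hV0o : IsOpen V0 := by
    refine hV.inter ?_
    rw [Set.ofPred_forall]
    exact isOpen_iInter_of_finite fun j =>
      isOpen_lt continuous_const (continuous_const.mul (continuous_apply j))
  have hc0V0 : c0 ∈ V0 := ⟨hc0V, fun j => (hσ0 j).2⟩
  rcases line_exists a ha σ with hl | ⟨p, q, hqK, hq0, hqne, hline⟩
  · refine ⟨V0, Set.inter_subset_left, hV0o, ⟨c0, hc0V0⟩, fun c hc =>
      ⟨sign_ne (hσV c hc), fun T hT => ?_⟩⟩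
    rcases T.eq_empty_or_nonempty with rfl | ⟨z, hz⟩
    · simp
    · have h1 := (crit_ell a (hσV c hc) (hT z hz)).2
      rw [hl _ (hT z hz).2.2] at h1
      exact absurd h1 (lt_irrefl _)
  by_cases hintr : ∃ s, ∀ j, q j ≠ 0 → 0 < σ j * (p j + s * q j)
  · obtain ⟨s₀, hs₀⟩ := hintr
    set h0 := ∑ j, q j * Real.log (p j + s₀ * q j) with hh0
    let κ : (Fin (n + 3) → ℝ) → ℝ := fun c => ∑ j, q j * Real.log |c j|
    have hκ : ContinuousOn κ V0 := by
      refine continuousOn_finsetSum _ fun j _ => continuousOn_const.mul ?_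
      refine ContinuousOn.log (continuous_apply j).abs.continuousOn fun c hc =>
        abs_ne_zero.mpr (sign_ne (hσV c hc) j)
    refine ⟨V0 ∩ κ ⁻¹' {h0}ᶜ, fun c hc => hc.1.1,
      hκ.isOpen_inter_preimage hV0o isOpen_compl_singleton, ?_, fun c hc =>
      ⟨sign_ne (hσV c hc.1), fun T hT => crit_count a (hσV c hc.1) hqK hq0 hline
        (fun s _ => ⟨s₀, hs₀, fun he => hc.2 he.symm⟩) T hT⟩⟩
    by_cases hκ0 : κ c0 = h0
    · obtain ⟨i, hi⟩ : ∃ i, q i ≠ 0 := by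
        by_contra hall
        push Not at hall
        exact hqne (funext hall)
      let g : ℝ → (Fin (n + 3) → ℝ) := fun t => Function.update c0 i (c0 i * Real.exp t)
      have hg : Continuous g := continuous_const.update i (by fun_prop)
      have hg0 : g 0 = c0 := by simp [g]
      have hmem : g ⁻¹' V0 ∈ nhds (0 : ℝ) :=
        (hV0o.preimage hg).mem_nhds (by rw [Set.mem_preimage, hg0]; exact hc0V0)
      obtain ⟨t, htV, ht0⟩ := (infinite_of_mem_nhds (0 : ℝ) hmem).exists_notMem_finite
        (Set.finite_singleton (0 : ℝ))
      refine ⟨g t, htV, ?_⟩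
      intro he
      have he : κ (g t) = h0 := he
      have e1 : κ (g t) = κ c0 + q i * t := by
        have : ∀ j, q j * Real.log |g t j| = q j * Real.log |c0 j| + if j = i then q i * t else 0 := by
          intro j
          by_cases hj : j = i
          · subst hj
            have : g t j = c0 j * Real.exp t := by simp [g]
            rw [this, abs_mul, Real.log_mul (abs_ne_zero.mpr (hc0' j)) (by positivity),
              abs_of_pos (Real.exp_pos t), Real.log_exp]
            simp; ring
          · simp [g, hj]
        simp only [κ]
        rw [Finset.sum_congr rfl fun j _ => this j, Finset.sum_add_distrib]
        simp
      rw [e1, hκ0] at he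
      have : q i * t = 0 := by linarith
      exact ht0 ((mul_eq_zero.mp this).resolve_left hi)
    · exact ⟨c0, hc0V0, hκ0⟩
  · exact ⟨V0, Set.inter_subset_left, hV0o, ⟨c0, hc0V0⟩, fun c hc =>
      ⟨sign_ne (hσV c hc), fun T hT => crit_count a (hσV c hc) hqK hq0 hline
        (fun s hs => absurd ⟨s, hs⟩ hintr) T hT⟩⟩

lemma bad_closed {n N : ℕ} [Nonempty (Fin N)] (a : Fin N → Fin n → ℝ) :
    IsClosed {c : Fin N → ℝ | ∃ z ∈ orb a, InK a (fun j => c j * z j)} := by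
  haveI : CompactSpace (orb a) := isCompact_iff_compactSpace.mp (orb_compact a)
  have hcl : IsClosed {w : (Fin N → ℝ) × orb a | InK a (fun j => w.1 j * w.2.1 j)} := by
    unfold InK
    have hc1 : ∀ j, Continuous fun w : (Fin N → ℝ) × orb a => w.1 j * w.2.1 j := fun j =>
      ((continuous_apply j).comp continuous_fst).mul
        ((continuous_apply j).comp (continuous_subtype_val.comp continuous_snd))
    have h1 : IsClosed {w : (Fin N → ℝ) × orb a | ∑ j, w.1 j * w.2.1 j = 0} :=
      isClosed_eq (continuous_finsetSum _ fun j _ => hc1 j) continuous_const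
    have h2 : ∀ i, IsClosed {w : (Fin N → ℝ) × orb a | ∑ j, w.1 j * w.2.1 j * a j i = 0} :=
      fun i => isClosed_eq
        (continuous_finsetSum _ fun j _ => (hc1 j).mul continuous_const) continuous_const
    have := h1.inter (isClosed_iInter h2)
    convert this using 1
    ext w
    simp
  have := isClosedMap_fst_of_compactSpace _ hcl
  convert this using 1
  ext c
  simp

lemma crit_finite {n N : ℕ} (a : Fin N → Fin n → ℝ) (c : Fin N → ℝ) (M : ℕ)
    (h : ∀ T : Finset (Fin N → ℝ), (∀ z ∈ T, z ∈ Crit a c) → T.card ≤ M) : (Crit a c).Finite := by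
  by_contra hinf
  obtain ⟨T, hT, hc⟩ := Set.Infinite.exists_subset_card_eq hinf (M + 1)
  have := h T fun z hz => hT hz
  omega

lemma step2 {n N : ℕ} [Nonempty (Fin N)] (a : Fin N → Fin n → ℝ) (V1 : Set (Fin N → ℝ))
    (hV1 : IsOpen V1) (c : Fin N → ℝ) (hcV : c ∈ V1) (hc : ∀ j, c j ≠ 0)
    (hfin : (Crit a c).Finite) :
    (V1 \ {c : Fin N → ℝ | ∃ z ∈ orb a, InK a (fun j => c j * z j)}).Nonempty := by
  let g : ℝ → (Fin N → ℝ) := fun μ j => c j - μ * |c j|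
  have hg : Continuous g := by fun_prop
  have hg0 : g 0 = c := by funext j; simp [g]
  have hmem : g ⁻¹' V1 ∩ {μ | |μ| < 1} ∈ nhds (0 : ℝ) :=
    ((hV1.preimage hg).inter (isOpen_lt continuous_abs continuous_const)).mem_nhds
      ⟨by rw [Set.mem_preimage, hg0]; exact hcV, by simp⟩
  obtain ⟨μ, ⟨hμV, hμ1⟩, hμ⟩ := (infinite_of_mem_nhds (0 : ℝ) hmem).exists_notMem_finite
    (hfin.image (rho c))
  refine ⟨g μ, hμV, ?_⟩
  rintro ⟨z, hz, hk⟩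
  apply hμ
  have hsz := orb_subset a hz
  have h1 : ∑ j, c j * z j = μ * ∑ j, |c j| * z j := by
    have h2 := hk.1
    simp only [g, sub_mul, Finset.sum_sub_distrib, mul_assoc] at h2
    rw [← Finset.mul_sum] at h2
    linarith
  have hr : rho c z = μ := by
    unfold rho
    rw [h1, mul_div_cancel_right₀ _ (absum_pos hc hsz).ne']
  exact ⟨z, ⟨hz, by rw [hr]; exact hμ1, by rw [hr]; exact hk⟩, hr⟩

lemma rho_neg {N : ℕ} (c z : Fin N → ℝ) : rho (-c) z = - rho c z := by
  unfold rho
  simp [neg_div]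

lemma crit_neg {n N : ℕ} (a : Fin N → Fin n → ℝ) (c z : Fin N → ℝ) :
    z ∈ Crit a (-c) ↔ z ∈ Crit a c := by
  unfold Crit InK
  simp only [Set.mem_ofPred_eq, rho_neg, abs_neg, Pi.neg_apply]
  have h : ∀ j, (-c j - -rho c z * |c j|) * z j = -((c j - rho c z * |c j|) * z j) :=
    fun j => by ring
  simp only [h]
  simp only [neg_mul _ (a _ _), Finset.sum_neg_distrib, neg_eq_zero]

lemma expSum_neg {n N : ℕ} (a : Fin N → Fin n → ℝ) (c : Fin N → ℝ) (y : Fin n → ℝ) :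
    expSum a (-c) y = - expSum a c y := by
  unfold expSum
  simp

lemma reg_comps {n N : ℕ} [Nonempty (Fin N)] (a : Fin N → Fin n → ℝ) (c : Fin N → ℝ) (M : ℕ)
    (hc : ∀ j, c j ≠ 0)
    (h : ∀ T : Finset (Fin N → ℝ), (∀ z ∈ T, z ∈ Crit a c) → T.card ≤ M)
    (hreg : ∀ z ∈ Crit a c, rho c z ≠ 0) :
    Finite (ConnectedComponents {y : Fin n → ℝ // expSum a c y = 0}) ∧
        Nat.card (ConnectedComponents {y : Fin n → ℝ // expSum a c y = 0}) ≤ N + M - 1 := by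
  classical
  have hfin := crit_finite a c M h
  have hF : hfin.toFinset.card ≤ M := h _ fun z hz => by simpa using hz
  obtain ⟨la, hla⟩ := labels a hc hreg
  obtain ⟨lb, hlb⟩ := labels a (c := -c) (fun j => by simpa using hc j)
    (fun z hz => by
      rw [rho_neg]
      simpa using hreg z ((crit_neg a c z).mp hz))
  letI i1 : Fintype {z // z ∈ Crit a c ∧ 0 < rho c z} :=
    Fintype.subtype (hfin.toFinset.filter fun z => 0 < rho c z) (by simp)
  letI i2 : Fintype {z // z ∈ Crit a (-c) ∧ 0 < rho (-c) z} :=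
    Fintype.subtype (hfin.toFinset.filter fun z => rho c z < 0) (by simp [crit_neg, rho_neg])
  have k1 : Fintype.card {z // z ∈ Crit a c ∧ 0 < rho c z} =
      (hfin.toFinset.filter fun z => 0 < rho c z).card := Fintype.subtype_card _ (by simp)
  have k2 : Fintype.card {z // z ∈ Crit a (-c) ∧ 0 < rho (-c) z} =
      (hfin.toFinset.filter fun z => rho c z < 0).card :=
    Fintype.subtype_card _ (by simp [crit_neg, rho_neg])
  have k3 : (hfin.toFinset.filter fun z => 0 < rho c z).card +
      (hfin.toFinset.filter fun z => rho c z < 0).card ≤ M := by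
    rw [← Finset.card_union_of_disjoint (Finset.disjoint_filter.mpr fun z _ h1 h2 => by linarith)]
    exact (Finset.card_le_card (Finset.union_subset (Finset.filter_subset _ _)
      (Finset.filter_subset _ _))).trans hF
  have k4 : Fintype.card {i // 0 < c i} + Fintype.card {i // 0 < (-c) i} ≤ N := by
    rw [Fintype.card_subtype, Fintype.card_subtype,
      ← Finset.card_union_of_disjoint (Finset.disjoint_filter.mpr fun z _ h1 h2 => by
        simp at h2; linarith)]
    exact (Finset.card_le_univ _).trans (by simp)
  refine comps_le _ _ fun m e he hes => ?_
  have := mv_count (expSum a c) (expSum_continuous a c) la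
    (fun y => lb ⟨y.1, by rw [expSum_neg]; have := y.2; linarith⟩) hla
    (fun y y' hyy => by
      obtain ⟨S, s1, s2, s3, s4⟩ := hlb _ _ hyy
      refine ⟨S, s1, fun w hw => ?_, s3, s4⟩
      have h1 : 0 ≤ expSum a (-c) w := s2 hw
      rw [expSum_neg] at h1
      show expSum a c w ≤ 0
      linarith) m e he hes
  rw [Fintype.card_sum, Fintype.card_sum, k1, k2] at this
  omega

end generic

theorem stmt1 (n : ℕ) (hn : 1 ≤ n)
    (a : Fin (n + 3) → Fin n → ℝ)
    (ha : NotAllInAffineHyperplane a) :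
    ∃ U : Set (Fin (n + 3) → ℝ), IsOpen U ∧ Dense U ∧
      ∀ c ∈ U,
        Finite (ConnectedComponents {y : Fin n → ℝ // expSum a c y = 0}) ∧
        Nat.card (ConnectedComponents {y : Fin n → ℝ // expSum a c y = 0})
          ≤ (n + 3) * (n + 2) / 2 + (n + 5) / 2 := by
  refine ⟨interior {c | Finite (ConnectedComponents {y : Fin n → ℝ // expSum a c y = 0}) ∧
        Nat.card (ConnectedComponents {y : Fin n → ℝ // expSum a c y = 0})
          ≤ (n + 3) * (n + 2) / 2 + (n + 5) / 2}, isOpen_interior, ?_,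
    fun c hc => (interior_subset hc :)⟩
  rw [dense_iff_inter_open]
  intro V hV hVn
  obtain ⟨V1, hV1V, hV1o, ⟨c, hc⟩, hV1⟩ := step1 a ha V hV hVn
  obtain ⟨c', hc'⟩ := step2 a V1 hV1o c hc (hV1 c hc).1 (crit_finite a c _ (hV1 c hc).2)
  refine ⟨c', hV1V hc'.1, ?_⟩
  refine mem_interior.mpr ⟨_, ?_, hV1o.sdiff (bad_closed a), hc'⟩
  rintro d ⟨hd1, hd2⟩
  obtain ⟨h1, h2⟩ := hV1 d hd1
  have h3 := reg_comps a d _ h1 h2 (fun z hz h0 => hd2 ⟨z, hz.1, by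
    have := hz.2.2
    simpa [h0] using this⟩)
  refine ⟨h3.1, h3.2.trans ?_⟩
  obtain ⟨m, rfl⟩ : ∃ m, n = m + 1 := ⟨n - 1, by omega⟩
  have h4 : 8 * m + 12 ≤ (m + 1 + 3) * (m + 1 + 2) := by
    rcases m with _ | m
    · norm_num
    · nlinarith
  omega
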